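/- arXiv:2011.08522 — 3 statements merged into one kernel-verified Lean document; each statement's English description precedes it below -/
import Mathlib

section
/- If G is a directed bipartite graph with at least one edge, then the associative spectrum of the graph algebra A(G) is constant 2: s_n = 2 for all n ≥ 3. More precisely, for n ≥ 3, two bracketings t, t' ∈ B_n induce the same term operation on A(G) if and only if t = t' or neither of t, t' is the left-nested bracketing ((⋯((x_1x_2)x_3)⋯)x_{n−1})x_n. -/
open Classical

/-- Bracketings of size `n`: binary terms in which `x_1, …, x_n` occur
exactly once, in this order. -/
inductive Bracketing : ℕ → Type
  | leaf : Bracketing 1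
  | node : {m k : ℕ} → Bracketing m → Bracketing k → Bracketing (m + k)

/-- The `n`-ary term operation induced by a bracketing on a groupoid `(α, mul)`. -/
def Bracketing.eval {α : Type*} (mul : α → α → α) : {n : ℕ} → Bracketing n → (Fin n → α) → α
  | _, .leaf, f => f ⟨0, Nat.one_pos⟩
  | _, .node l r, f =>
      mul (Bracketing.eval mul l fun i => f (Fin.castAdd _ i))
          (Bracketing.eval mul r fun i => f (Fin.natAdd _ i))

/-- The multiplication of the graph algebra `A(G)` of a digraph `G = (V, E)`;
`none` plays the role of `∞`. -/
noncomputable def gmul {V : Type*} (E : V → V → Prop) : Option V → Option V → Option V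
  | some x, some y => if E x y then some x else none
  | _, _ => none

/-- The graph algebra `A(G)` satisfies the bracketing identity `t ≈ t'`. -/
def GASat {V : Type*} (E : V → V → Prop) {n : ℕ} (t t' : Bracketing n) : Prop :=
  ∀ f : Fin n → Option V, t.eval (gmul E) f = t'.eval (gmul E) f

/-- `s_n(A(G))`: the number of distinct `n`-ary term operations induced by
bracketings of size `n` on the graph algebra of `(V, E)`. -/
noncomputable def assocSpectrum {V : Type*} (E : V → V → Prop) (n : ℕ) : ℕ :=
  Nat.card (Set.range fun t : Bracketing n => fun f : Fin n → Option V => t.eval (gmul E) f)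

/-- Depth sequences of DFS trees (zag sequences): `d(x_1) = 0` and
`1 ≤ d(x_{i+1}) ≤ d(x_i) + 1`.  DFS trees of size `n` are in bijection with
such sequences. -/
def IsZag (n : ℕ) (d : Fin n → ℕ) : Prop :=
  (∀ h : 0 < n, d ⟨0, h⟩ = 0) ∧
  ∀ (i : ℕ) (h : i + 1 < n),
    1 ≤ d ⟨i + 1, h⟩ ∧ d ⟨i + 1, h⟩ ≤ d ⟨i, Nat.lt_of_succ_lt h⟩ + 1

/-- `j` is the parent of `i` in the DFS tree with depth sequence `d`:
the largest index below `i` whose depth is `d i - 1`. -/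
def isParent {n : ℕ} (d : Fin n → ℕ) (j i : Fin n) : Prop :=
  j < i ∧ d j + 1 = d i ∧ ∀ k : Fin n, j < k → k < i → d k + 1 ≠ d i

/-- `j` is a vertex of the induced subtree rooted at `i` of the DFS tree with
depth sequence `d`. -/
def descend {n : ℕ} (d : Fin n → ℕ) (i j : Fin n) : Prop :=
  i ≤ j ∧ ∀ k : Fin n, i < k → k ≤ j → d i < d k

/-- The induced subtrees rooted at `i` of the DFS trees with depth sequences
`d` and `d'` are equal (same vertex sets and same relative depths). -/
def subtreeEq {n : ℕ} (d d' : Fin n → ℕ) (i : Fin n) : Prop :=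
  (∀ j, descend d i j ↔ descend d' i j) ∧
  ∀ j, descend d i j → d j - d i = d' j - d' i

/-- The height of the induced subtree rooted at `i`. -/
noncomputable def subHeight {n : ℕ} (d : Fin n → ℕ) (i : Fin n) : ℕ :=
  Finset.univ.sup fun j => if descend d i j then d j - d i else 0

/-- The depth sequence of the DFS tree `G(t)` of a bracketing `t`, as a list. -/
def Bracketing.depthList : {n : ℕ} → Bracketing n → List ℕ
  | _, .leaf => [0]
  | _, .node l r => l.depthList ++ r.depthList.map (· + 1)

theorem Bracketing.length_depthList : ∀ {n : ℕ} (t : Bracketing n), t.depthList.length = n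
  | _, .leaf => rfl
  | _, .node l r => by simp [Bracketing.depthList, length_depthList l, length_depthList r]

/-- The depth sequence of the DFS tree `G(t)` of a bracketing `t`. -/
def Bracketing.depth {n : ℕ} (t : Bracketing n) (i : Fin n) : ℕ :=
  t.depthList.get (Fin.cast t.length_depthList.symm i)

/-- The vertex `a` lies on a directed cycle, i.e. it belongs to a nontrivial
strongly connected component. -/
def inCycle {V : Type*} (E : V → V → Prop) (a : V) : Prop :=
  ∃ b, E a b ∧ Relation.ReflTransGen E b a

/-- `a` and `b` are mutually reachable. -/
def sameSCC {V : Type*} (E : V → V → Prop) (a b : V) : Prop :=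
  Relation.ReflTransGen E a b ∧ Relation.ReflTransGen E b a

/-- `K` is a strongly connected component of `(V, E)`. -/
def IsSCC {V : Type*} (E : V → V → Prop) (K : Set V) : Prop :=
  ∃ a, K = {b | sameSCC E a b}

/-- `K` is a nontrivial strongly connected component (contains an edge). -/
def IsNontrivialSCC {V : Type*} (E : V → V → Prop) (K : Set V) : Prop :=
  IsSCC E K ∧ ∃ u ∈ K, ∃ v ∈ K, E u v

/-- `w 0 → w 1 → ⋯ → w ℓ` is a walk in `(V, E)`. -/
def IsWalk {V : Type*} (E : V → V → Prop) (w : ℕ → V) (ℓ : ℕ) : Prop :=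
  ∀ i, i < ℓ → E (w i) (w (i + 1))

/-- `w 0 → ⋯ → w ℓ` is an outlet: `w 0` lies in a nontrivial strongly connected
component and `w 1 → ⋯ → w ℓ` is a pleasant path. -/
def IsOutlet {V : Type*} (E : V → V → Prop) (w : ℕ → V) (ℓ : ℕ) : Prop :=
  IsWalk E w ℓ ∧ inCycle E (w 0) ∧ ∀ i, 1 ≤ i → i ≤ ℓ → ¬ inCycle E (w i)

/-- `K` is an `m`-whirl with block structure `β`: the blocks are the fibres of
`β` (all nonempty), and the edges inside `K` are exactly those from a block to
the cyclically next one. -/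
def IsWhirl {V : Type*} (E : V → V → Prop) (K : Set V) (m : ℕ) (β : V → ZMod m) : Prop :=
  1 ≤ m ∧ (∀ a ∈ K, ∀ b ∈ K, (E a b ↔ β b = β a + 1)) ∧
  ∀ c : ZMod m, ∃ a ∈ K, β a = c

/-- The parameter `Y_{t,t'}`: the largest integer `m` such that all induced
subtrees of height at most `m` of the two DFS trees coincide. -/
noncomputable def Ypar {n : ℕ} (d d' : Fin n → ℕ) : ℤ :=
  sSup {m : ℤ | ∀ i : Fin n,
    ((subHeight d i : ℤ) ≤ m ∨ (subHeight d' i : ℤ) ≤ m) → subtreeEq d d' i}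

/-- The parameter `Z_{t,t'}`: the smallest `m` such that some vertex has equal
induced subtrees of height `m` in the two DFS trees but different parents. -/
noncomputable def Zpar {n : ℕ} (d d' : Fin n → ℕ) : ℕ :=
  sInf {m : ℕ | ∃ i : Fin n, subtreeEq d d' i ∧ subHeight d i = m ∧
    ¬ ∀ j, (isParent d j i ↔ isParent d' j i)}

/-- `R_n`: binary words of length `n` that do not start with `01`, do not end
with `10` and do not contain `101` (with `0 := false`, `1 := true`). -/
def Rset (n : ℕ) : Set (List Bool) :=
  {ρ | ρ.length = n ∧ ¬ [false, true] <+: ρ ∧ ¬ [true, false] <:+ ρ ∧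
    ¬ [true, false, true] <:+: ρ}

/-- The three-element vertex set `{u, v, w}`. -/
inductive V3 : Type | u | v | w

/-- The edge relation of the digraph `G0` with edges `(u,v)`, `(u,w)`, `(w,w)`. -/
def E0 : V3 → V3 → Prop
  | .u, .v => True
  | .u, .w => True
  | .w, .w => True
  | _, _ => False

/-- The edge relation of the induced subgraph on `W`. -/
def inducedE {V : Type*} (E : V → V → Prop) (W : Set V) : ↥W → ↥W → Prop :=
  fun x y => E x.1 y.1

/-- The weakly connected component of `a`. -/
def wcc {V : Type*} (E : V → V → Prop) (a : V) : Set V :=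
  {b | Relation.ReflTransGen (fun x y => E x y ∨ E y x) a b}

/-- The bracketing `x_1 (x_2 x_3)`. -/
def assocL : Bracketing 3 := .node .leaf (.node .leaf .leaf)

/-- The bracketing `(x_1 x_2) x_3`. -/
def assocR : Bracketing 3 := .node (.node .leaf .leaf) .leaf

/-- Left-nested bracketings `((⋯((x_1 x_2) x_3)⋯) x_{n-1}) x_n`. -/
inductive Bracketing.IsLeftNested : {n : ℕ} → Bracketing n → Prop
  | leaf : IsLeftNested .leaf
  | node {n : ℕ} {t : Bracketing n} : IsLeftNested t → IsLeftNested (.node t .leaf)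

/-- The weakly connected component of `a` is associative: its graph algebra
satisfies `x_1 (x_2 x_3) ≈ (x_1 x_2) x_3`. -/
noncomputable def CompAssoc {V : Type*} (E : V → V → Prop) (a : V) : Prop :=
  GASat (inducedE E (wcc E a)) assocL assocR

/-- The weakly connected component of `a` is a directed bipartite graph with at
least one edge. -/
def CompBip {V : Type*} (E : V → V → Prop) (a : V) : Prop :=
  (∃ f : ↥(wcc E a) → Bool, ∀ x y : ↥(wcc E a), inducedE E (wcc E a) x y →
    f x = true ∧ f y = false) ∧ ∃ x y : ↥(wcc E a), inducedE E (wcc E a) x y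

/-- The map `ρ ↦ ρ1 / ρ00 / ρ1000` from `R_{n-1} ⊔ R_{n-2} ⊔ R_{n-4}`. -/
def psi (n : ℕ) : ↥(Rset (n - 1)) ⊕ ↥(Rset (n - 2)) ⊕ ↥(Rset (n - 4)) → List Bool
  | .inl ρ => ρ.1 ++ [true]
  | .inr (.inl ρ) => ρ.1 ++ [false, false]
  | .inr (.inr ρ) => ρ.1 ++ [true, false, false, false]

namespace Bracketing

theorem one_le_size : ∀ {n : ℕ}, Bracketing n → 1 ≤ n
  | _, .leaf => le_rfl
  | _, .node l _ => le_add_right (one_le_size l)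

/-- The left-nested bracketing of size `n + 1`. -/
def leftNested : (n : ℕ) → Bracketing (n + 1)
  | 0 => .leaf
  | n + 1 => .node (leftNested n) .leaf

theorem isLeftNested_leftNested : ∀ n : ℕ, (leftNested n).IsLeftNested
  | 0 => .leaf
  | n + 1 => .node (isLeftNested_leftNested n)

theorem IsLeftNested.heq_leftNested {n : ℕ} {t : Bracketing n} (ht : t.IsLeftNested) :
    ∀ m : ℕ, n = m + 1 → HEq t (leftNested m) := by
  induction ht with
  | leaf =>
    intro m hm
    obtain rfl : m = 0 := by omega
    rfl
  | @node n t _ ih =>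
    intro m hm
    obtain rfl : n = m := by omega
    cases n with
    | zero => exact absurd t.one_le_size (by simp)
    | succ k => rw [eq_of_heq (ih k rfl)]; rfl

theorem IsLeftNested.unique {n : ℕ} {t t' : Bracketing n} (ht : t.IsLeftNested)
    (ht' : t'.IsLeftNested) : t = t' := by
  obtain ⟨m, rfl⟩ := Nat.exists_eq_add_of_le' t.one_le_size
  exact eq_of_heq ((ht.heq_leftNested m rfl).trans (ht'.heq_leftNested m rfl).symm)

end Bracketing

section GraphAlgebra

variable {V : Type*} {E : V → V → Prop}

theorem gmul_eq_some_iff {x y : Option V} {a : V} :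
    gmul E x y = some a ↔ x = some a ∧ ∃ b, y = some b ∧ E a b := by
  cases x <;> cases y <;> simp [gmul]
  grind

namespace Bracketing

/-- In a directed bipartite graph algebra, a product whose right factor is itself a product
is always `∞`. -/
theorem eval_node_eq_none (hbip : ∃ f : V → Bool, ∀ a b, E a b → f a = true ∧ f b = false)
    {m k : ℕ} (l : Bracketing m) (r : Bracketing k) (hk : 2 ≤ k) (f : Fin (m + k) → Option V) :
    (node l r).eval (gmul E) f = none := by
  obtain ⟨c, hc⟩ := hbip
  rw [Option.eq_none_iff_forall_ne_some]
  intro a ha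
  obtain ⟨-, b, hb, hab⟩ := gmul_eq_some_iff.1 ha
  cases r with
  | leaf => omega
  | node r₁ r₂ =>
    obtain ⟨-, d, -, hbd⟩ := gmul_eq_some_iff.1 hb
    simpa [(hc a b hab).2] using (hc b d hbd).1

theorem eval_eq_none_of_not_isLeftNested
    (hbip : ∃ f : V → Bool, ∀ a b, E a b → f a = true ∧ f b = false)
    {n : ℕ} {t : Bracketing n} (ht : ¬ t.IsLeftNested) (f : Fin n → Option V) :
    t.eval (gmul E) f = none := by
  induction t with
  | leaf => exact absurd .leaf ht
  | node l r ihl _ =>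
    cases r with
    | leaf => simp [eval, gmul, ihl fun hl => ht hl.node]
    | node r₁ r₂ =>
      exact eval_node_eq_none hbip l _ (add_le_add r₁.one_le_size r₂.one_le_size) f

theorem IsLeftNested.eval_eq_some {a b : V} (hab : E a b) {n : ℕ} {t : Bracketing n}
    (ht : t.IsLeftNested) :
    t.eval (gmul E) (fun i => if i.val = 0 then some a else some b) = some a := by
  induction ht with
  | leaf => rfl
  | @node n t _ ih =>
    rw [eval, gmul_eq_some_iff]
    refine ⟨ih, b, ?_, hab⟩
    simp [eval, Nat.one_le_iff_ne_zero.1 t.one_le_size]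

theorem exists_not_isLeftNested
    (hbip : ∃ f : V → Bool, ∀ a b, E a b → f a = true ∧ f b = false)
    (hedge : ∃ a b, E a b) {n : ℕ} (hn : 3 ≤ n) : ∃ t : Bracketing n, ¬ t.IsLeftNested := by
  obtain ⟨k, rfl⟩ := Nat.exists_eq_add_of_le hn
  obtain ⟨a, b, hab⟩ := hedge
  have hk : 1 + (1 + k + 1) = 3 + k := by omega
  rw [← hk]
  refine ⟨.node .leaf (leftNested (1 + k)), fun h => ?_⟩
  have := h.eval_eq_some hab
  rw [eval_node_eq_none hbip _ _ (by omega)] at this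
  cases this

end Bracketing

theorem gaSat_iff_of_bipartite
    (hbip : ∃ f : V → Bool, ∀ a b, E a b → f a = true ∧ f b = false)
    (hedge : ∃ a b, E a b) {n : ℕ} (t t' : Bracketing n) :
    GASat E t t' ↔ (t = t' ∨ (¬ t.IsLeftNested ∧ ¬ t'.IsLeftNested)) := by
  constructor
  · intro h
    obtain ⟨a, b, hab⟩ := hedge
    by_cases ht : t.IsLeftNested <;> by_cases ht' : t'.IsLeftNested
    · exact .inl (ht.unique ht')
    · have := ht.eval_eq_some hab
      rw [h, Bracketing.eval_eq_none_of_not_isLeftNested hbip ht'] at this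
      cases this
    · have := ht'.eval_eq_some hab
      rw [← h, Bracketing.eval_eq_none_of_not_isLeftNested hbip ht] at this
      cases this
    · exact .inr ⟨ht, ht'⟩
  · rintro (rfl | ⟨ht, ht'⟩) f
    · rfl
    · rw [Bracketing.eval_eq_none_of_not_isLeftNested hbip ht,
        Bracketing.eval_eq_none_of_not_isLeftNested hbip ht']

theorem assocSpectrum_eq_two_of_bipartite
    (hbip : ∃ f : V → Bool, ∀ a b, E a b → f a = true ∧ f b = false)
    (hedge : ∃ a b, E a b) {n : ℕ} (hn : 3 ≤ n) : assocSpectrum E n = 2 := by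
  have hs : ∃ s : Bracketing n, s.IsLeftNested := by
    obtain ⟨k, rfl⟩ := Nat.exists_eq_add_of_le' (show 1 ≤ n by omega)
    exact ⟨_, Bracketing.isLeftNested_leftNested k⟩
  obtain ⟨s, hs⟩ := hs
  obtain ⟨u, hu⟩ := Bracketing.exists_not_isLeftNested hbip hedge hn
  rw [assocSpectrum, Nat.card_coe_set_eq, Set.ncard_eq_two]
  refine ⟨s.eval (gmul E), u.eval (gmul E), fun h => ?_, ?_⟩
  · rcases (gaSat_iff_of_bipartite hbip hedge s u).1 (congrFun h) with rfl | h
    exacts [hu hs, h.1 hs]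
  · ext g
    simp only [Set.mem_range, Set.mem_insert_iff, Set.mem_singleton_iff]
    constructor
    · rintro ⟨t, rfl⟩
      by_cases ht : t.IsLeftNested
      · exact .inl (by rw [ht.unique hs])
      · exact .inr (funext ((gaSat_iff_of_bipartite hbip hedge t u).2 (.inr ⟨ht, hu⟩)))
    · rintro (rfl | rfl)
      exacts [⟨s, rfl⟩, ⟨u, rfl⟩]

end GraphAlgebra

/-- if `(V, E)` is a directed bipartite graph with at least one
edge, then the associative spectrum of its graph algebra is constant `2`; more
precisely, for `n ≥ 3` two bracketings induce the same term operation iff they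
are equal or neither of them is the left-nested bracketing. -/
theorem bipartite_spectrum_const_two {V : Type*} (E : V → V → Prop)
    (hbip : ∃ f : V → Bool, ∀ a b, E a b → f a = true ∧ f b = false)
    (hedge : ∃ a b, E a b) :
    (∀ n, 3 ≤ n → assocSpectrum E n = 2) ∧
    ∀ n : ℕ, 3 ≤ n → ∀ t t' : Bracketing n,
      (GASat E t t' ↔ (t = t' ∨ (¬ t.IsLeftNested ∧ ¬ t'.IsLeftNested))) := by
  exact ⟨fun n hn => assocSpectrum_eq_two_of_bipartite hbip hedge hn,
    fun n _ t t' => gaSat_iff_of_bipartite hbip hedge t t'⟩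
end

section
/- Let G be a digraph. The associative spectrum of the graph algebra A(G) is constant 2 (i.e., s_n = 2 for all n ≥ 3) if and only if each weakly connected component of G is either associative or a directed bipartite graph with at least one edge, and at least one weakly connected component is a directed bipartite graph with at least one edge. -/
open Classical

theorem gmul_eq_some {V : Type*} {E : V → V → Prop} {x y : Option V} {a : V} :
    gmul E x y = some a ↔ x = some a ∧ ∃ b, y = some b ∧ E a b := by
  rcases x with _ | x <;> rcases y with _ | y <;> simp only [gmul]
  · simp
  · simp
  · simp
  · split_ifs with h
    · simp only [Option.some.injEq, exists_eq_left']
      constructor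
      · rintro rfl
        exact ⟨rfl, h⟩
      · exact fun h => h.1
    · simp only [Option.some.injEq, exists_eq_left', false_iff]
      rintro ⟨rfl, h'⟩
      exact h h'

/-- `f` maps the first variable to `a` and all other ones to out-neighbours of `a`. -/
def StarAt {V : Type*} (E : V → V → Prop) {n : ℕ} (f : Fin n → Option V) (a : V) : Prop :=
  ∀ i : Fin n, if i.1 = 0 then f i = some a else ∃ b, f i = some b ∧ E a b

theorem Bracketing.pos : {n : ℕ} → Bracketing n → 0 < n
  | _, .leaf => Nat.one_pos
  | _, .node l _ => Nat.add_pos_left l.pos _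

theorem starAt_leaf {V : Type*} {E : V → V → Prop} (f : Fin 1 → Option V) (a : V) :
    StarAt E f a ↔ f 0 = some a := by
  simp [StarAt]

theorem starAt_add {V : Type*} {E : V → V → Prop} {m k : ℕ} (hm : 0 < m)
    (f : Fin (m + k) → Option V) (a : V) :
    StarAt E f a ↔ StarAt E (fun i => f (Fin.castAdd k i)) a ∧
      ∀ i, ∃ b, f (Fin.natAdd m i) = some b ∧ E a b := by
  unfold StarAt
  rw [Fin.forall_fin_add]
  refine and_congr Iff.rfl (forall_congr' fun i => ?_)
  rw [if_neg]
  simp only [Fin.val_natAdd]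
  omega

/-- In a part of the digraph closed under out-neighbours and satisfying the associativity
condition, every bracketing is satisfied exactly by the stars. -/
theorem eval_eq_some_iff_of_assoc {V : Type*} {E : V → V → Prop} {P : V → Prop}
    (hP : ∀ a b, P a → E a b → P b) (hE : ∀ a b c, P a → E a b → (E b c ↔ E a c))
    {n : ℕ} (t : Bracketing n) (f : Fin n → Option V) {a : V} (ha : P a) :
    t.eval (gmul E) f = some a ↔ StarAt E f a := by
  induction t generalizing a with
  | leaf => rw [starAt_leaf]; rfl
  | node l r ihl ihr =>
    rw [Bracketing.eval, gmul_eq_some, starAt_add l.pos, ihl _ ha]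
    refine and_congr Iff.rfl ⟨?_, fun h => ?_⟩
    · rintro ⟨b, hb, hab⟩ i
      rw [ihr _ (hP a b ha hab)] at hb
      have hi := hb i
      split_ifs at hi
      · exact ⟨b, hi, hab⟩
      · obtain ⟨c, hc, hbc⟩ := hi
        exact ⟨c, hc, (hE a b c ha hab).1 hbc⟩
    · obtain ⟨b, hb, hab⟩ := h ⟨0, r.pos⟩
      refine ⟨b, ?_, hab⟩
      rw [ihr _ (hP a b ha hab)]
      intro i
      split_ifs with hi
      · obtain rfl : i = ⟨0, r.pos⟩ := Fin.ext hi
        exact hb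
      · obtain ⟨c, hc, hac⟩ := h i
        exact ⟨c, hc, (hE a b c ha hab).2 hac⟩

/-- The bracketing is a single variable. -/
def Bracketing.IsLeaf : {n : ℕ} → Bracketing n → Prop
  | _, .leaf => True
  | _, .node _ _ => False

/-- The bracketing is left-nested, as a recursive predicate. -/
def Bracketing.LeftNested : {n : ℕ} → Bracketing n → Prop
  | _, .leaf => True
  | _, .node l r => l.LeftNested ∧ r.IsLeaf

theorem eval_eq_some_iff_of_leftNested {V : Type*} {E : V → V → Prop} {n : ℕ}
    (t : Bracketing n) (ht : t.LeftNested) (f : Fin n → Option V) (a : V) :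
    t.eval (gmul E) f = some a ↔ StarAt E f a := by
  induction t with
  | leaf => rw [starAt_leaf]; rfl
  | node l r ihl _ =>
    cases r with
    | leaf =>
      rw [Bracketing.eval, gmul_eq_some, starAt_add l.pos, ihl ht.1]
      refine and_congr Iff.rfl ⟨fun h i => ?_, fun h => h 0⟩
      rw [Fin.fin_one_eq_zero i]
      exact h
    | node _ _ => exact ht.2.elim

theorem exists_walk_of_not_leftNested {V : Type*} {E : V → V → Prop} {n : ℕ}
    (t : Bracketing n) (ht : ¬ t.LeftNested) (f : Fin n → Option V) (a : V)
    (h : t.eval (gmul E) f = some a) : ∃ b c, E a b ∧ E b c := by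
  induction t with
  | leaf => exact (ht trivial).elim
  | node l r ihl _ =>
    rw [Bracketing.eval, gmul_eq_some] at h
    obtain ⟨hl, b, hr, hab⟩ := h
    cases r with
    | leaf => exact ihl (fun h => ht ⟨h, trivial⟩) _ hl
    | node _ _ =>
      rw [Bracketing.eval, gmul_eq_some] at hr
      obtain ⟨-, c, -, hbc⟩ := hr
      exact ⟨b, c, hab, hbc⟩

theorem exists_leftNested (n : ℕ) : ∃ t : Bracketing (n + 1), t.LeftNested := by
  induction n with
  | zero => exact ⟨.leaf, trivial⟩
  | succ n ih =>
    obtain ⟨t, ht⟩ := ih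
    exact ⟨.node t .leaf, ht, trivial⟩

theorem exists_not_leftNested (n : ℕ) : ∃ t : Bracketing (n + 3), ¬ t.LeftNested := by
  obtain ⟨t, -⟩ := exists_leftNested n
  change ∃ t : Bracketing (n + 1 + (1 + 1)), _
  exact ⟨.node t (.node .leaf .leaf), fun h => h.2⟩

theorem gaSat_assoc_iff {V : Type*} {E : V → V → Prop} :
    GASat E assocL assocR ↔ ∀ a b c, E a b → (E b c ↔ E a c) := by
  have hL (f : Fin 3 → Option V) :
      assocL.eval (gmul E) f = gmul E (f 0) (gmul E (f 1) (f 2)) := rfl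
  have hR (f : Fin 3 → Option V) :
      assocR.eval (gmul E) f = gmul E (gmul E (f 0) (f 1)) (f 2) := rfl
  constructor
  · intro h a b c hab
    have := congrArg (· = some a) (h ![some a, some b, some c])
    simpa [hL, hR, gmul_eq_some, hab] using this
  · intro h f
    rw [hL, hR]
    ext a
    simp only [gmul_eq_some]
    constructor
    · rintro ⟨h0, b, ⟨h1, c, h2, hbc⟩, hab⟩
      exact ⟨⟨h0, b, h1, hab⟩, c, h2, (h a b c hab).1 hbc⟩
    · rintro ⟨⟨h0, b, h1, hab⟩, c, h2, hac⟩
      exact ⟨h0, b, ⟨h1, c, h2, (h a b c hab).2 hac⟩, hab⟩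

theorem mem_wcc_self {V : Type*} (E : V → V → Prop) (a : V) : a ∈ wcc E a :=
  Relation.ReflTransGen.refl

theorem mem_wcc_of_edge {V : Type*} {E : V → V → Prop} {a b c : V} (hb : b ∈ wcc E a)
    (h : E b c) : c ∈ wcc E a :=
  Relation.ReflTransGen.tail hb (Or.inl h)

theorem wcc_eq_of_edge {V : Type*} {E : V → V → Prop} {a b : V} (h : E a b) :
    wcc E a = wcc E b := by
  ext c
  exact ⟨fun hc => Relation.ReflTransGen.head (Or.inr h) hc,
    fun hc => Relation.ReflTransGen.head (Or.inl h) hc⟩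

theorem compAssoc_iff {V : Type*} {E : V → V → Prop} {a : V} :
    CompAssoc E a ↔ ∀ x y z, x ∈ wcc E a → E x y → (E y z ↔ E x z) := by
  rw [CompAssoc, gaSat_assoc_iff]
  constructor
  · intro h x y z hx hxy
    have hy := mem_wcc_of_edge hx hxy
    exact ⟨fun hyz => (h ⟨x, hx⟩ ⟨y, hy⟩ ⟨z, mem_wcc_of_edge hy hyz⟩ hxy).1 hyz,
      fun hxz => (h ⟨x, hx⟩ ⟨y, hy⟩ ⟨z, mem_wcc_of_edge hx hxz⟩ hxy).2 hxz⟩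
  · intro h x y z hxy
    exact h x y z x.2 hxy

theorem CompAssoc.of_edge {V : Type*} {E : V → V → Prop} {a b : V} (h : CompAssoc E a)
    (hab : E a b) : CompAssoc E b := by
  rw [compAssoc_iff] at h ⊢
  rwa [← wcc_eq_of_edge hab]

theorem CompBip.no_walk {V : Type*} {E : V → V → Prop} {a x y z : V} (h : CompBip E a)
    (hx : x ∈ wcc E a) (hxy : E x y) (hyz : E y z) : False := by
  obtain ⟨⟨f, hf⟩, -⟩ := h
  have hy := mem_wcc_of_edge hx hxy
  have h1 := (hf ⟨x, hx⟩ ⟨y, hy⟩ hxy).2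
  have h2 := (hf ⟨y, hy⟩ ⟨z, mem_wcc_of_edge hy hyz⟩ hyz).1
  simp [h1] at h2

theorem gaSat_of_assoc {V : Type*} {E : V → V → Prop}
    (h : ∀ a b c, E a b → (E b c ↔ E a c)) {n : ℕ} (t t' : Bracketing n) : GASat E t t' := by
  intro f
  ext a
  have := fun s : Bracketing n => eval_eq_some_iff_of_assoc (E := E) (P := fun _ => True)
    (fun _ _ _ _ => trivial) (fun a b c _ => h a b c) s f (a := a) trivial
  rw [this, this]

theorem assocSpectrum_eq_two_iff {V : Type*} {E : V → V → Prop} {n : ℕ} :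
    assocSpectrum E n = 2 ↔ ∃ t t' : Bracketing n, ¬ GASat E t t' ∧
      ∀ s : Bracketing n, GASat E s t ∨ GASat E s t' := by
  rw [assocSpectrum, Nat.card_coe_set_eq, Set.ncard_eq_two]
  simp only [GASat, ← funext_iff]
  constructor
  · rintro ⟨x, y, hxy, h⟩
    obtain ⟨t, rfl⟩ := h.ge (Set.mem_insert x {y})
    obtain ⟨t', rfl⟩ := h.ge (Set.mem_insert_of_mem _ rfl)
    refine ⟨t, t', hxy, fun s => ?_⟩
    exact h.le (Set.mem_range_self s)
  · rintro ⟨t, t', hne, h⟩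
    refine ⟨_, _, hne, Set.Subset.antisymm ?_ ?_⟩
    · rintro _ ⟨s, rfl⟩
      exact h s
    · rintro _ (rfl | rfl)
      exacts [⟨t, rfl⟩, ⟨t', rfl⟩]

theorem assocSpectrum_eq_two_of_components {V : Type*} {E : V → V → Prop}
    (h : ∀ a : V, CompAssoc E a ∨ CompBip E a) (hex : ∃ a : V, CompBip E a) {n : ℕ}
    (hn : 3 ≤ n) : assocSpectrum E n = 2 := by
  obtain ⟨n, rfl⟩ := Nat.exists_eq_add_of_le' hn
  obtain ⟨t, ht⟩ := exists_leftNested (n + 2)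
  obtain ⟨t', ht'⟩ := exists_not_leftNested n
  have key (s : Bracketing (n + 3)) (hs : ¬ s.LeftNested) (f : Fin (n + 3) → Option V) (a : V) :
      s.eval (gmul E) f = some a ↔ CompAssoc E a ∧ StarAt E f a := by
    by_cases ha : CompAssoc E a
    · simp only [ha, true_and]
      exact eval_eq_some_iff_of_assoc (fun _ _ => CompAssoc.of_edge)
        (fun x y z hx => compAssoc_iff.1 hx x y z (mem_wcc_self E x)) s f ha
    · simp only [ha, false_and, iff_false]
      intro hsa
      obtain ⟨b, c, hab, hbc⟩ := exists_walk_of_not_leftNested s hs f a hsa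
      exact ((h a).resolve_left ha).no_walk (mem_wcc_self E a) hab hbc
  refine assocSpectrum_eq_two_iff.2 ⟨t, t', fun hsat => ?_, fun s => ?_⟩
  · obtain ⟨a, ha⟩ := hex
    obtain ⟨x, y, hxy⟩ := ha.2
    let f : Fin (n + 3) → Option V := fun i => if i.1 = 0 then some x.1 else some y.1
    have hf : StarAt E f x.1 := by
      intro i
      by_cases hi : i.1 = 0
      · rw [if_pos hi]
        exact if_pos hi
      · rw [if_neg hi]
        exact ⟨y.1, if_neg hi, hxy⟩
    have := (eval_eq_some_iff_of_leftNested t ht f x.1).2 hf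
    rw [hsat f] at this
    obtain ⟨b, c, hab, hbc⟩ := exists_walk_of_not_leftNested t' ht' f x.1 this
    exact ha.no_walk x.2 hab hbc
  · by_cases hs : s.LeftNested
    · refine Or.inl fun f => ?_
      ext a
      rw [eval_eq_some_iff_of_leftNested s hs, eval_eq_some_iff_of_leftNested t ht]
    · refine Or.inr fun f => ?_
      ext a
      rw [key s hs, key t' ht']

/-- If the bracketings of size 4 induce two operations only and the multiplication is not
associative, then the four bracketings that are not left-nested induce the same operation. -/
theorem edge_conditions_of_assocSpectrum_four {V : Type*} {E : V → V → Prop}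
    (h : assocSpectrum E 4 = 2) (hna : ¬ ∀ a b c, E a b → (E b c ↔ E a c)) (a b c d : V) :
    ((E a b ∧ E a c ∧ E c d) ↔ (E a b ∧ E b c ∧ E c d)) ∧
      ((E a b ∧ E b c ∧ E a d) ↔ (E a b ∧ E b c ∧ E c d)) ∧
      ((E a b ∧ E b c ∧ E b d) ↔ (E a b ∧ E b c ∧ E c d)) := by
  let star : Bracketing 4 := .node (.node (.node .leaf .leaf) .leaf) .leaf
  let tB : Bracketing 4 := .node (.node .leaf .leaf) (.node .leaf .leaf)
  let tC : Bracketing 4 := .node (.node .leaf (.node .leaf .leaf)) .leaf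
  let tD : Bracketing 4 := .node .leaf (.node (.node .leaf .leaf) .leaf)
  let path : Bracketing 4 := .node .leaf (.node .leaf (.node .leaf .leaf))
  have hstar (a b c d : V) : star.eval (gmul E) ![some a, some b, some c, some d] = some a ↔
      E a b ∧ E a c ∧ E a d := by
    change gmul E (gmul E (gmul E (some a) (some b)) (some c)) (some d) = _ ↔ _
    simp [gmul_eq_some, and_assoc]
  have hB (a b c d : V) : tB.eval (gmul E) ![some a, some b, some c, some d] = some a ↔
      E a b ∧ E a c ∧ E c d := by
    change gmul E (gmul E (some a) (some b)) (gmul E (some c) (some d)) = _ ↔ _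
    simp [gmul_eq_some]
    tauto
  have hC (a b c d : V) : tC.eval (gmul E) ![some a, some b, some c, some d] = some a ↔
      E a b ∧ E b c ∧ E a d := by
    change gmul E (gmul E (some a) (gmul E (some b) (some c))) (some d) = _ ↔ _
    simp [gmul_eq_some]
    tauto
  have hD (a b c d : V) : tD.eval (gmul E) ![some a, some b, some c, some d] = some a ↔
      E a b ∧ E b c ∧ E b d := by
    change gmul E (some a) (gmul E (gmul E (some b) (some c)) (some d)) = _ ↔ _
    simp [gmul_eq_some]
    tauto
  have hpath (a b c d : V) : path.eval (gmul E) ![some a, some b, some c, some d] = some a ↔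
      E a b ∧ E b c ∧ E c d := by
    change gmul E (some a) (gmul E (some b) (gmul E (some c) (some d))) = _ ↔ _
    simp [gmul_eq_some]
    tauto
  have sat {t t' : Bracketing 4} (h : GASat E t t') (a b c d : V) :
      t.eval (gmul E) ![some a, some b, some c, some d] = some a ↔
        t'.eval (gmul E) ![some a, some b, some c, some d] = some a := by rw [h]
  have nB : ¬ GASat E star tB := fun h => hna fun a b c hab => by
    have := sat h a b b c
    rw [hstar, hB] at this
    tauto
  have nC : ¬ GASat E star tC := fun h => hna fun a b c hab => by
    have := sat h a b c b
    rw [hstar, hC] at this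
    tauto
  have nD : ¬ GASat E star tD := fun h => hna fun a b c hab => by
    have := sat h a b c c
    rw [hstar, hD] at this
    tauto
  have npath : ¬ GASat E star path := fun h => hna fun a b c hab => by
    have h1 := sat h a b b b
    have h2 := sat h a b b c
    rw [hstar, hpath] at h1 h2
    tauto
  obtain ⟨t, t', -, hs⟩ := assocSpectrum_eq_two_iff.1 h
  have pigeon {u v : Bracketing 4} (hu : ¬ GASat E star u) (hv : ¬ GASat E star v) :
      GASat E u v := by
    have symm {x y : Bracketing 4} (h : GASat E x y) : GASat E y x := fun f => (h f).symm
    have trans {x y z : Bracketing 4} (h : GASat E x y) (h' : GASat E y z) : GASat E x z :=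
      fun f => (h f).trans (h' f)
    rcases hs star with h0 | h0 <;> rcases hs u with h1 | h1 <;> rcases hs v with h2 | h2
    all_goals first
      | exact trans h1 (symm h2)
      | exact (hu (trans h0 (symm h1))).elim
      | exact (hv (trans h0 (symm h2))).elim
  rw [← hB, ← hC, ← hD, ← hpath]
  exact ⟨sat (pigeon nB npath) _ _ _ _, sat (pigeon nC npath) _ _ _ _,
    sat (pigeon nD npath) _ _ _ _⟩

theorem components_of_assocSpectrum_eq_two {V : Type*} {E : V → V → Prop}
    (h : ∀ n, 3 ≤ n → assocSpectrum E n = 2) :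
    (∀ a : V, CompAssoc E a ∨ CompBip E a) ∧ ∃ a : V, CompBip E a := by
  have hna : ¬ ∀ a b c, E a b → (E b c ↔ E a c) := fun hE => by
    obtain ⟨t, t', hne, -⟩ := assocSpectrum_eq_two_iff.1 (h 3 le_rfl)
    exact hne (gaSat_of_assoc hE t t')
  have h4 := edge_conditions_of_assocSpectrum_four (h 4 (by norm_num)) hna
  have loop {x y z : V} (hxy : E x y) (hyz : E y z) : E y y :=
    ((h4 x y y z).1.1 ⟨hxy, hxy, hyz⟩).2.1
  have walk_out {x y z w : V} (hxy : E x y) (hyz : E y z) (hxw : E x w) : E w y :=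
    ((h4 x w y z).1.1 ⟨hxw, hxy, hyz⟩).2.1
  have trans {x y z : V} (hxy : E x y) (hyz : E y z) : E x z :=
    ((h4 x y y z).2.1.2 ⟨hxy, loop hxy hyz, hyz⟩).2.2
  have all : ∀ a : V, CompAssoc E a ∨ CompBip E a := by
    intro a
    by_cases hw : ∃ y z, E a y ∧ E y z
    · left
      have mem : ∀ b ∈ wcc E a, ∃ y z, E b y ∧ E y z := by
        intro b hb
        induction hb with
        | refl => exact hw
        | tail _ hbc ih =>
          obtain ⟨y, z, hby, hyz⟩ := ih
          rcases hbc with hbc | hcb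
          · exact ⟨y, z, walk_out hby hyz hbc, hyz⟩
          · exact ⟨_, y, hcb, hby⟩
      refine compAssoc_iff.2 fun x y z hx hxy => ⟨trans hxy, fun hxz => ?_⟩
      obtain ⟨y', z', hxy', hyz'⟩ := mem x hx
      exact walk_out hxz (walk_out hxy' hyz' hxz) hxy
    · have mem : ∀ b ∈ wcc E a, ¬ ∃ y z, E b y ∧ E y z := by
        intro b hb
        induction hb with
        | refl => exact hw
        | tail _ hbc ih =>
          rintro ⟨y, z, hcy, hyz⟩
          rcases hbc with hbc | hcb
          · exact ih ⟨_, y, hbc, hcy⟩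
          · exact ih ⟨y, z, walk_out hcy hyz hcb, hyz⟩
      by_cases he : ∃ x y : ↥(wcc E a), inducedE E (wcc E a) x y
      · refine Or.inr ⟨⟨fun x => decide (∃ y, E x.1 y), fun x y hxy => ?_⟩, he⟩
        refine ⟨decide_eq_true ⟨_, hxy⟩, decide_eq_false ?_⟩
        rintro ⟨z, hyz⟩
        exact mem x x.2 ⟨_, z, hxy, hyz⟩
      · refine Or.inl (compAssoc_iff.2 fun x y z hx hxy => ?_)
        exact (he ⟨⟨x, hx⟩, ⟨y, mem_wcc_of_edge hx hxy⟩, hxy⟩).elim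
  refine ⟨all, ?_⟩
  by_contra hbip
  push Not at hbip
  exact hna fun a b c hab =>
    compAssoc_iff.1 ((all a).resolve_right (hbip a)) a b c (mem_wcc_self E a) hab

/-- Theorem 9.7(ii): the associative spectrum of the graph
algebra of a digraph `(V, E)` is constant `2` iff every weakly connected
component is associative or a directed bipartite graph with at least one edge,
and at least one component is of the latter kind. -/
theorem spectrum_const_two_iff {V : Type*} (E : V → V → Prop) :
    (∀ n, 3 ≤ n → assocSpectrum E n = 2) ↔
      ((∀ a : V, CompAssoc E a ∨ CompBip E a) ∧ ∃ a : V, CompBip E a) := by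
  constructor
  · exact components_of_assocSpectrum_eq_two
  · rintro ⟨h, hex⟩ n hn
    exact assocSpectrum_eq_two_of_components h hex hn
end

section
/- For every digraph G, exactly one of the following holds: either s_n(A(G)) ≤ 2 for all n ≥ 3, or s_n(A(G)) ≥ |R_{n−1}| for all n ≥ 3. In particular, the associative spectrum of a graph algebra is either a constant sequence bounded above by 2 or it grows exponentially, with growth rate at least Θ(α^n) where α ≈ 1.755 is the unique positive real root of x^4 − x^3 − x^2 − 1. -/
open Classical

namespace Bracketing

variable {V : Type*} {E : V → V → Prop}

/-- The assignment `f` is a homomorphism from the DFS tree of the bracketing to `(V, E)`. -/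
def Sat (E : V → V → Prop) : {n : ℕ} → Bracketing n → (ℕ → V) → Prop
  | _, .leaf, _ => True
  | _, .node (m := m) l r, f =>
      Sat E l f ∧ Sat E r (fun i => f (m + i)) ∧ E (f 0) (f m)

theorem size_pos : ∀ {n : ℕ}, Bracketing n → 0 < n
  | _, .leaf => Nat.one_pos
  | _, .node l _ => Nat.add_pos_left (size_pos l) _

theorem eval_some {n : ℕ} (t : Bracketing n) (f : ℕ → V) :
    t.eval (gmul E) (fun i => some (f i)) = if Sat E t f then some (f 0) else none := by
  induction t generalizing f with
  | leaf => simp [eval, Sat]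
  | @node m k l r ihl ihr =>
    have hl := ihl f
    have hr := ihr fun i => f (m + i)
    simp only [eval, Fin.val_castAdd, Fin.val_natAdd, hl, hr, Sat]
    by_cases h1 : Sat E l f <;> by_cases h2 : Sat E r (fun i => f (m + i)) <;>
      simp [h1, h2, gmul]

theorem eval_eq_none {n : ℕ} (t : Bracketing n) (F : Fin n → Option V)
    (h : ∃ i, F i = none) : t.eval (gmul E) F = none := by
  induction t with
  | leaf =>
    obtain ⟨i, hi⟩ := h
    rw [Subsingleton.elim i ⟨0, Nat.one_pos⟩] at hi
    simpa [eval] using hi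
  | node l r ihl ihr =>
    obtain ⟨i, hi⟩ := h
    simp only [eval]
    induction i using Fin.addCases with
    | left i => rw [ihl _ ⟨i, hi⟩]; simp [gmul]
    | right i => rw [ihr _ ⟨i, hi⟩]; simp [gmul]

theorem gaSat_iff {n : ℕ} (t t' : Bracketing n) :
    GASat E t t' ↔ ∀ f : ℕ → V, Sat E t f ↔ Sat E t' f := by
  constructor
  · intro h f
    have := h fun i => some (f i)
    rw [eval_some, eval_some] at this
    by_cases h1 : Sat E t f <;> by_cases h2 : Sat E t' f <;> simp_all
  · intro h F
    by_cases hF : ∃ i, F i = none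
    · rw [eval_eq_none t F hF, eval_eq_none t' F hF]
    · push Not at hF
      choose g hg using fun i => Option.ne_none_iff_exists'.1 (hF i)
      obtain ⟨f, rfl⟩ : ∃ f : ℕ → V, F = fun i : Fin n => some (f i) :=
        ⟨fun j => if h : j < n then g ⟨j, h⟩ else g ⟨0, t.size_pos⟩, by funext i; simp [hg]⟩
      rw [eval_some, eval_some]
      simp only [h]

/-- The vertices that lie on the rightmost branch of the DFS tree. -/
def Branch : {n : ℕ} → Bracketing n → ℕ → Prop
  | _, .leaf, v => v = 0
  | _, .node (m := m) _ r, v => v = 0 ∨ (m ≤ v ∧ Branch r (v - m))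

theorem branch_zero {n : ℕ} (t : Bracketing n) : t.Branch 0 := by
  cases t <;> simp [Branch]

/-- A new last vertex can be attached to any vertex of the rightmost branch. -/
theorem exists_attach (E : V → V → Prop) {n : ℕ} (t : Bracketing n) (v : ℕ)
    (hv : t.Branch v) :
    ∃ t' : Bracketing (n + 1), (∀ f, Sat E t' f ↔ Sat E t f ∧ E (f v) (f n)) ∧
      t'.Branch n ∧ t'.Branch v := by
  have base {n : ℕ} (t : Bracketing n) :
      ∃ t' : Bracketing (n + 1), (∀ f, Sat E t' f ↔ Sat E t f ∧ E (f 0) (f n)) ∧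
        t'.Branch n ∧ t'.Branch 0 :=
    ⟨.node t .leaf, fun f => by simp [Sat], by simp [Branch], by simp [Branch]⟩
  induction t generalizing v with
  | leaf =>
    obtain rfl : v = 0 := hv
    exact base _
  | @node m k l r _ ihr =>
    rcases hv with rfl | ⟨hm, hv⟩
    · exact base _
    · obtain ⟨r', h1, h2, h3⟩ := ihr _ hv
      have hsat (f : ℕ → V) :
          Sat E (.node l r') f ↔ Sat E (.node l r) f ∧ E (f v) (f (m + k)) := by
        have : m + (v - m) = v := by omega
        simp only [Sat, h1, this]
        tauto
      have hbranch : (Bracketing.node l r').Branch (m + k) := Or.inr ⟨by omega, by simpa using h2⟩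
      exact ⟨_, hsat, hbranch, Or.inr ⟨hm, h3⟩⟩

/-! ### Two families of bracketings -/

/-- The last vertex up to `j` of depth one in the tree of height at most two in which
`j + 1` has depth two iff `e j`. -/
noncomputable def lastTop (e : ℕ → Prop) : ℕ → ℕ
  | 0 => 0
  | j + 1 => if e j then lastTop e j else j + 1

/-- The last vertex up to `j` that is `0` or satisfies `e`. -/
noncomputable def lastInner (e : ℕ → Prop) : ℕ → ℕ
  | 0 => 0
  | j + 1 => if e (j + 1) then j + 1 else lastInner e j

theorem exists_shallow (E : V → V → Prop) (e : ℕ → Prop) (n : ℕ) :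
    ∃ t : Bracketing (n + 1), (∀ f, Sat E t f ↔
      ∀ j < n, E (f (if e j then lastTop e j else 0)) (f (j + 1))) ∧
      t.Branch (lastTop e n) := by
  induction n with
  | zero => exact ⟨.leaf, by simp [Sat], rfl⟩
  | succ n ih =>
    obtain ⟨t, h1, h2⟩ := ih
    by_cases he : e n
    · obtain ⟨t', h3, -, h5⟩ := exists_attach E t _ h2
      refine ⟨t', fun f => ?_, by simpa [lastTop, he] using h5⟩
      rw [h3, h1, Nat.forall_lt_succ_right]
      simp only [he, if_true]
    · obtain ⟨t', h3, h4, -⟩ := exists_attach E t 0 t.branch_zero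
      refine ⟨t', fun f => ?_, by simpa [lastTop, he] using h4⟩
      rw [h3, h1, Nat.forall_lt_succ_right]
      simp only [he, if_false]

theorem exists_caterpillar (E : V → V → Prop) (e : ℕ → Prop) (n : ℕ) :
    ∃ t : Bracketing (n + 1), (∀ f, Sat E t f ↔
      ∀ j < n, E (f (lastInner e j)) (f (j + 1))) ∧ t.Branch (lastInner e n) := by
  induction n with
  | zero => exact ⟨.leaf, by simp [Sat], rfl⟩
  | succ n ih =>
    obtain ⟨t, h1, h2⟩ := ih
    obtain ⟨t', h3, h4, h5⟩ := exists_attach E t _ h2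
    refine ⟨t', fun f => by rw [h3, h1, Nat.forall_lt_succ_right], ?_⟩
    by_cases he : e (n + 1) <;> simpa [lastInner, he]

theorem lastTop_le (e : ℕ → Prop) (j : ℕ) : lastTop e j ≤ j := by
  induction j with
  | zero => simp [lastTop]
  | succ j ih => rw [lastTop]; split_ifs <;> omega

theorem exists_lastTop_eq {e : ℕ → Prop} (h0 : ¬ e 0) {j : ℕ} (hj : 1 ≤ j) :
    ∃ i, lastTop e j = i + 1 ∧ ¬ e i := by
  induction j, hj using Nat.le_induction with
  | base => exact ⟨0, by simp [lastTop, h0], h0⟩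
  | succ j _ ih =>
    by_cases he : e j
    · simpa [lastTop, he] using ih
    · exact ⟨j, by simp [lastTop, he], he⟩

theorem apply_lastTop {e : ℕ → Prop} {j : ℕ} (hj : e j) : e (lastTop e j) := by
  induction j with
  | zero => exact hj
  | succ j ih =>
    rw [lastTop]
    split_ifs with h
    · exact ih h
    · exact hj

theorem lastInner_eq_zero_or (e : ℕ → Prop) (j : ℕ) :
    lastInner e j = 0 ∨ e (lastInner e j) := by
  induction j with
  | zero => simp [lastInner]
  | succ j ih =>
    rw [lastInner]
    split_ifs with h
    · exact Or.inr h
    · exact ih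

theorem exists_forall_shallow_iff (E : V → V → Prop) (n : ℕ) :
    ∃ T : (ℕ → Prop) → Bracketing (n + 1), ∀ e f, Sat E (T e) f ↔
      ∀ j < n, E (f (if e j then lastTop e j else 0)) (f (j + 1)) := by
  choose T hT _ using fun e => exists_shallow E e n
  exact ⟨T, hT⟩

theorem exists_forall_caterpillar_iff (E : V → V → Prop) (n : ℕ) :
    ∃ T : (ℕ → Prop) → Bracketing (n + 1), ∀ e f, Sat E (T e) f ↔
      ∀ j < n, E (f (lastInner e j)) (f (j + 1)) := by
  choose T hT _ using fun e => exists_caterpillar E e n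
  exact ⟨T, hT⟩

/-- The DFS tree is a star. -/
def IsStar : {n : ℕ} → Bracketing n → Prop
  | _, .leaf => True
  | _, .node (k := k) l _ => IsStar l ∧ k = 1

theorem sat_of_size_eq_one {n : ℕ} (t : Bracketing n) (hn : n = 1) (f : ℕ → V) : Sat E t f := by
  cases t with
  | leaf => trivial
  | node l r => have := l.size_pos; have := r.size_pos; omega

theorem IsStar.sat_iff {n : ℕ} {t : Bracketing n} (ht : t.IsStar) (f : ℕ → V) :
    Sat E t f ↔ ∀ j, 1 ≤ j → j < n → E (f 0) (f j) := by
  induction t with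
  | leaf => simp only [Sat, true_iff]; omega
  | @node m k l r ihl _ =>
    obtain ⟨hl, rfl⟩ := ht
    have hm := l.size_pos
    have hr : Sat E r fun i => f (m + i) := r.sat_of_size_eq_one rfl _
    simp only [Sat, ihl hl, hr, true_and]
    constructor
    · rintro ⟨h1, h2⟩ j hj hj'
      rcases Nat.lt_succ_iff_lt_or_eq.1 hj' with h | rfl
      · exact h1 j hj h
      · exact h2
    · exact fun h => ⟨fun j hj hj' => h j hj (by omega), h m hm (by omega)⟩

theorem sat_of_forall {n : ℕ} (t : Bracketing n) (f : ℕ → V)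
    (h : ∀ i j, i < n → 1 ≤ j → j < n → E (f i) (f j)) : Sat E t f := by
  induction t generalizing f with
  | leaf => trivial
  | node l r ihl ihr =>
    have := l.size_pos
    have := r.size_pos
    exact ⟨ihl f fun i j hi hj hj' => h i j (by omega) hj (by omega),
      ihr _ fun i j hi hj hj' => h _ _ (by omega) (by omega) (by omega),
      h _ _ (by omega) (by omega) (by omega)⟩

theorem Sat.edge_root {n : ℕ} {t : Bracketing n} {f : ℕ → V}
    (hE : ∀ a b c, E a b → E b c → E a c) (h : Sat E t f) :
    ∀ j, 1 ≤ j → j < n → E (f 0) (f j) := by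
  induction t generalizing f with
  | leaf => omega
  | @node m k l r ihl ihr =>
    obtain ⟨h1, h2, h3⟩ := h
    intro j hj hj'
    rcases lt_trichotomy j m with hm | rfl | hm
    · exact ihl h1 j hj hm
    · exact h3
    · have := ihr h2 (j - m) (by omega) (by omega)
      rw [show m + (j - m) = j by omega] at this
      exact hE _ _ _ h3 this

theorem Sat.exists_loop {n : ℕ} {t : Bracketing n} {f : ℕ → V}
    (hE : ∀ a b c, E a b → E b c → E a c) (hL : ∀ a b c, E a b → E b c → E b b)
    (ht : ¬ t.IsStar) (h : Sat E t f) : ∃ p, 1 ≤ p ∧ p < n ∧ E (f p) (f p) := by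
  induction t with
  | leaf => exact absurd trivial ht
  | @node m k l r ihl _ =>
    obtain ⟨h1, h2, h3⟩ := h
    have hl := l.size_pos
    have hr := r.size_pos
    by_cases hs : l.IsStar
    · have hk : k ≠ 1 := fun hk => ht ⟨hs, hk⟩
      exact ⟨m, hl, by omega, hL _ _ _ h3 (h2.edge_root hE 1 le_rfl (by omega))⟩
    · obtain ⟨p, hp, hp', hpp⟩ := ihl hs h1
      exact ⟨p, hp, by omega, hpp⟩

end Bracketing

section Spectrum

open Bracketing

variable {V : Type*} {E : V → V → Prop}

theorem assocSpectrum_le_two (hE : ∀ a b c, E a b → E b c → E a c)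
    (hL : ∀ a b c, E a b → E b c → E b b)
    (hB : ∀ x y z, E x y → E y y → E x z → E y z ∨ E z y)
    (hC : ∀ x y, E x x → E x y → E y x) (n : ℕ) : assocSpectrum E n ≤ 2 := by
  have key (t : Bracketing n) (ht : ¬ t.IsStar) (f : ℕ → V) (h : Sat E t f)
      (t' : Bracketing n) : Sat E t' f := by
    have hroot := h.edge_root hE
    obtain ⟨p, hp, hpn, hpp⟩ := h.exists_loop hE hL ht
    have hedge (y z : V) (hy : E (f 0) y) (hyy : E y y) (hz : E (f 0) z) : E y z := by
      rcases hB _ _ _ hy hyy hz with h | h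
      · exact h
      · exact hC _ _ (hL _ _ _ hz h) h
    refine sat_of_forall t' f fun i j hi hj hjn => ?_
    rcases Nat.eq_zero_or_pos i with rfl | hi0
    · exact hroot j hj hjn
    · have hpi := hedge _ _ (hroot p hp hpn) hpp (hroot i hi0 hi)
      exact hedge _ _ (hroot i hi0 hi) (hL _ _ _ hpi (hC _ _ hpp hpi)) (hroot j hj hjn)
  unfold assocSpectrum
  choose T hT using fun x : Set.range fun t : Bracketing n =>
    fun f : Fin n → Option V => t.eval (gmul E) f => x.2
  have hinj : Function.Injective fun x => decide (T x).IsStar := by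
    intro x y hxy
    simp only [decide_eq_decide] at hxy
    refine Subtype.ext ?_
    rw [← hT x, ← hT y]
    refine funext ((gaSat_iff _ _).2 fun f => ?_)
    by_cases hx : (T x).IsStar
    · rw [hx.sat_iff, (hxy.1 hx).sat_iff]
    · exact ⟨fun h => key _ hx f h _, fun h => key _ (mt hxy.2 hx) f h _⟩
  simpa using Nat.card_le_card_of_injective _ hinj

/-- Positions (counted from one) at which two consecutive zeros of the word start. -/
def doubleZero (ρ : List Bool) (i : ℕ) : Prop :=
  1 ≤ i ∧ ρ[i - 1]? = some false ∧ ρ[i]? = some false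

theorem getElem?_eq_false_iff {N : ℕ} (hN : 2 ≤ N) {ρ : List Bool} (hρ : ρ ∈ Rset N) {i : ℕ}
    (hi : i < N) : ρ[i]? = some false ↔ doubleZero ρ (i + 1) ∨ doubleZero ρ i := by
  obtain ⟨rfl, h1, h2, h3⟩ := hρ
  constructor
  · intro h
    have hi' : ρ[i] = false := by simpa [hi] using h
    by_contra! hcon
    obtain ⟨hr, hl⟩ := hcon
    have hr' (hlt : i + 1 < ρ.length) : ρ[i + 1] = true := by
      by_contra hf
      exact hr ⟨by omega, by simpa using h, by simpa [hlt] using hf⟩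
    have hl' (hpos : 1 ≤ i) : ρ[i - 1] = true := by
      by_contra hf
      exact hl ⟨hpos, by simpa [show i - 1 < ρ.length by omega] using hf, h⟩
    rcases Nat.eq_zero_or_pos i with rfl | hpos
    · refine h1 ⟨ρ.drop 2, ?_⟩
      rw [← List.drop_zero (l := ρ), List.drop_eq_getElem_cons hi,
        List.drop_eq_getElem_cons (show 0 + 1 < ρ.length by omega), hi', hr' (by omega)]
      simp
    · by_cases hlt : i + 1 < ρ.length
      · refine h3 ⟨ρ.take (i - 1), ρ.drop (i + 2), ?_⟩
        conv_rhs => rw [← List.take_append_drop (i - 1) ρ,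
          List.drop_eq_getElem_cons (show i - 1 < ρ.length by omega), hl' hpos]
        simp only [Nat.sub_add_cancel hpos]
        rw [List.drop_eq_getElem_cons hi, List.drop_eq_getElem_cons hlt, hi', hr' hlt]
        simp
      · refine h2 ⟨ρ.take (i - 1), ?_⟩
        conv_rhs => rw [← List.take_append_drop (i - 1) ρ,
          List.drop_eq_getElem_cons (show i - 1 < ρ.length by omega), hl' hpos]
        simp only [Nat.sub_add_cancel hpos]
        rw [List.drop_eq_getElem_cons hi, hi', List.drop_eq_nil_of_le (by omega)]
  · rintro (h | h)
    · exact h.2.1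
    · exact h.2.2

theorem finite_range_eval (E : V → V → Prop) (n : ℕ) :
    (Set.range fun t : Bracketing n => fun f : Fin n → Option V => t.eval (gmul E) f).Finite := by
  have : Finite (Bracketing n) := by
    induction n using Nat.strong_induction_on with
    | _ n ih =>
      have hfin : (insert ⟨1, .leaf⟩ (⋃ m ∈ Set.Iio n, ⋃ k ∈ Set.Iio n,
          Set.range fun p : Bracketing m × Bracketing k => ⟨m + k, .node p.1 p.2⟩) :
          Set (Σ n, Bracketing n)).Finite := by
        refine Set.Finite.insert _ ((Set.finite_Iio n).biUnion fun m hm =>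
          (Set.finite_Iio n).biUnion fun k hk => ?_)
        have := ih m hm
        have := ih k hk
        exact Set.finite_range _
      refine Set.finite_univ_iff.1 ((hfin.preimage sigma_mk_injective.injOn).subset
        fun t _ => ?_)
      cases t with
      | leaf => exact Set.mem_insert _ _
      | @node m k l r =>
        have := l.size_pos
        have := r.size_pos
        refine Set.mem_insert_of_mem _ (Set.mem_biUnion (show m < m + k by omega)
          (Set.mem_biUnion (show k < m + k by omega) ⟨(l, r), rfl⟩))
  exact Set.finite_range _

theorem card_Rset_le_assocSpectrum {n : ℕ} (hn : 2 ≤ n) (T : (ℕ → Prop) → Bracketing (n + 1))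
    (hT : ∀ e e' : ℕ → Prop, (∀ i, e i → 1 ≤ i ∧ i < n) → (∀ i, e' i → 1 ≤ i ∧ i < n) →
      (∀ f, Sat E (T e) f ↔ Sat E (T e') f) →
      ∀ i < n, ¬ e (i + 1) → ¬ e i → ¬ e' (i + 1) ∧ ¬ e' i) :
    Nat.card (Rset n) ≤ assocSpectrum E (n + 1) := by
  have hsupp (ρ : Rset n) (i : ℕ) (h : doubleZero ρ i) : 1 ≤ i ∧ i < n := by
    refine ⟨h.1, ?_⟩
    obtain ⟨hi, -⟩ := List.getElem?_eq_some_iff.1 h.2.2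
    rwa [ρ.2.1] at hi
  have : Finite (Set.range fun t : Bracketing (n + 1) =>
      fun f : Fin (n + 1) → Option V => t.eval (gmul E) f) := finite_range_eval E _
  refine Nat.card_le_card_of_injective (fun ρ : Rset n => ⟨_, T (doubleZero ρ), rfl⟩) ?_
  intro ρ σ h
  have hsat := (gaSat_iff _ _).1 (fun f => congrFun (Subtype.ext_iff.1 h) f)
  have hdir (ρ σ : Rset n)
      (hsat : ∀ f, Sat E (T (doubleZero ρ)) f ↔ Sat E (T (doubleZero σ)) f)
      (i : ℕ) (hi : i < n) (h : σ.1[i]? = some false) : ρ.1[i]? = some false := by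
    rw [getElem?_eq_false_iff hn ρ.2 hi]
    rw [getElem?_eq_false_iff hn σ.2 hi] at h
    by_contra! hcon
    have := hT _ _ (hsupp ρ) (hsupp σ) hsat i hi hcon.1 hcon.2
    tauto
  refine Subtype.ext (List.ext_getElem (ρ.2.1.trans σ.2.1.symm) fun i h1 h2 => ?_)
  have hi : i < n := by rwa [ρ.2.1] at h1
  have ha := hdir ρ σ hsat i hi
  have hb := hdir σ ρ (fun f => (hsat f).symm) i hi
  simp only [List.getElem?_eq_getElem h1, List.getElem?_eq_getElem h2, Option.some.injEq] at ha hb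
  exact Bool.eq_iff_iff.2 (by grind)

theorem card_Rset_le_of_walk {a b c : V} (hab : E a b) (hbc : E b c)
    (h : ¬ E a c ∨ ¬ E b b ∧ ¬ E c b) {n : ℕ} (hn : 2 ≤ n) :
    Nat.card (Rset n) ≤ assocSpectrum E (n + 1) := by
  obtain ⟨T, hT⟩ := exists_forall_shallow_iff E n
  refine card_Rset_le_assocSpectrum hn T fun e e' he he' hsat => ?_
  let F (e : ℕ → Prop) : ℕ → V
    | 0 => a
    | j + 1 => if e j then c else b
  have hF (e : ℕ → Prop) (he : ∀ i, e i → 1 ≤ i ∧ i < n) : Sat E (T e) (F e) := by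
    refine (hT _ _).2 fun j hj => ?_
    by_cases hej : e j
    · obtain ⟨i, hi, hei⟩ := exists_lastTop_eq (e := e) (fun h => by simpa using he 0 h)
        (he j hej).1
      simpa [hej, hi, F, hei] using hbc
    · simpa [hej, F] using hab
  have hcmp (e e' : ℕ → Prop) (he' : ∀ i, e' i → 1 ≤ i ∧ i < n) (hs : Sat E (T e') (F e))
      (j : ℕ) (hj : j < n) : (E a c ∨ (e j → e' j)) ∧ (E b b ∨ E c b ∨ (e' j → e j)) := by
    have hedge := (hT _ _).1 hs j hj
    by_cases hej' : e' j
    · obtain ⟨i, hi, -⟩ := exists_lastTop_eq (e := e') (fun h => by simpa using he' 0 h)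
        (he' j hej').1
      by_cases hei : e i <;> by_cases hej : e j <;> simp_all [F]
    · by_cases hej : e j <;> simp_all [F]
  have heq (j : ℕ) (hj : j < n) : e j ↔ e' j := by
    have h1 := hcmp e e' he' ((hsat _).1 (hF e he)) j hj
    have h2 := hcmp e' e he ((hsat _).2 (hF e' he')) j hj
    tauto
  intro i hi h1 h2
  refine ⟨fun h => h1 ((heq _ (he' _ h).2).2 h), fun h => h2 ((heq _ hi).2 h)⟩

theorem card_Rset_le_of_fork {x y z : V} (hxy : E x y) (hyy : E y y) (hxz : E x z)
    (hyz : ¬ E y z) (hzy : ¬ E z y) {n : ℕ} (hn : 2 ≤ n) :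
    Nat.card (Rset n) ≤ assocSpectrum E (n + 1) := by
  obtain ⟨T, hT⟩ := exists_forall_shallow_iff E n
  refine card_Rset_le_assocSpectrum hn T fun e e' he he' hsat i hi h1 h2 => ?_
  let F (j : ℕ) : V := if j = 0 then x else if j = i + 1 then z else y
  have hF : Sat E (T e) F := by
    refine (hT _ _).2 fun j hj => ?_
    by_cases hej : e j
    · obtain ⟨k, hk, hek⟩ := exists_lastTop_eq (e := e) (fun h => by simpa using he 0 h)
        (he j hej).1
      have hji : j ≠ i := by rintro rfl; exact h2 hej
      have hki : k ≠ i := by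
        rintro rfl
        exact h1 (hk ▸ apply_lastTop hej)
      simpa [hej, hk, F, hji, hki] using hyy
    · by_cases hji : j = i
      · subst hji
        simpa [hej, F]
      · simpa [hej, F, hji]
  have hF' := (hT _ _).1 ((hsat _).1 hF)
  have hei : ¬ e' i := by
    intro hei
    have := hF' i hi
    obtain ⟨k, hk, -⟩ := exists_lastTop_eq (e := e') (fun h => by simpa using he' 0 h)
      (he' i hei).1
    have hki : k ≠ i := by have := lastTop_le e' i; omega
    simp [hei, hk, F, hki] at this
    exact hyz this
  refine ⟨fun hei' => ?_, hei⟩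
  have := hF' (i + 1) (he' _ hei').2
  simp [hei', lastTop, hei, F] at this
  exact hzy this

theorem card_Rset_le_of_loop {x y : V} (hxx : E x x) (hxy : E x y) (hyx : ¬ E y x)
    {n : ℕ} (hn : 2 ≤ n) : Nat.card (Rset n) ≤ assocSpectrum E (n + 1) := by
  obtain ⟨T, hT⟩ := exists_forall_caterpillar_iff E n
  refine card_Rset_le_assocSpectrum hn T fun e e' he he' hsat => ?_
  have hcmp (i : ℕ) (hei : ¬ e i) : ¬ e' i := by
    intro hei'
    obtain ⟨hi, hin⟩ := he' i hei'
    let F (j : ℕ) : V := if j = i then y else x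
    have hF : Sat E (T e) F := by
      refine (hT _ _).2 fun j hj => ?_
      have hne : lastInner e j ≠ i := by
        rcases lastInner_eq_zero_or e j with h | h
        · omega
        · rintro rfl
          exact hei h
      by_cases hji : j + 1 = i <;> simpa [F, hne, hji]
    have := (hT _ _).1 ((hsat _).1 hF) i hin
    obtain ⟨k, rfl⟩ : ∃ k, i = k + 1 := ⟨i - 1, by omega⟩
    simp [lastInner, hei', F] at this
    exact hyx this
  exact fun i _ h1 h2 => ⟨hcmp _ h1, hcmp _ h2⟩

theorem two_lt_card_Rset_three : 2 < Nat.card (Rset 3) := by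
  have hfin : (Rset 3).Finite := (List.finite_length_eq Bool 3).subset fun _ h => h.1
  have hsub : ({[false, false, false], [false, false, true], [true, true, true]} :
      Set (List Bool)) ⊆ Rset 3 := by
    rintro ρ (rfl | rfl | rfl) <;> exact ⟨rfl, by decide, by decide, by decide⟩
  have := Set.ncard_le_ncard hsub hfin
  rw [Set.ncard_eq_three.2 ⟨_, _, _, by decide, by decide, by decide, rfl⟩] at this
  exact this

end Spectrum

/-- spectrum dichotomy, Theorem 9.7: for every digraph `(V, E)`
exactly one of the following holds: `s_n(A(G)) ≤ 2` for all `n ≥ 3`, or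
`s_n(A(G)) ≥ |R_{n-1}|` for all `n ≥ 3`. -/
theorem spectrum_dichotomy {V : Type*} (E : V → V → Prop) :
    ((∀ n, 3 ≤ n → assocSpectrum E n ≤ 2) ∨
      (∀ n, 3 ≤ n → Nat.card (Rset (n - 1)) ≤ assocSpectrum E n)) ∧
    ¬ ((∀ n, 3 ≤ n → assocSpectrum E n ≤ 2) ∧
        (∀ n, 3 ≤ n → Nat.card (Rset (n - 1)) ≤ assocSpectrum E n)) := by
  constructor
  · rw [or_iff_not_imp_right]
    intro h n _
    have hlow : ¬ ∀ n, 2 ≤ n → Nat.card (Rset n) ≤ assocSpectrum E (n + 1) := by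
      refine fun h' => h fun n hn => ?_
      obtain ⟨k, rfl⟩ : ∃ k, n = k + 1 := ⟨n - 1, by omega⟩
      exact h' k (by omega)
    have hE (a b c : V) (hab : E a b) (hbc : E b c) : E a c :=
      by_contra fun hac => hlow fun _ => card_Rset_le_of_walk hab hbc (Or.inl hac)
    have hL (a b c : V) (hab : E a b) (hbc : E b c) : E b b :=
      by_contra fun hbb => hlow fun _ => card_Rset_le_of_walk hab hbc
        (Or.inr ⟨hbb, fun hcb => hbb (hE _ _ _ hbc hcb)⟩)
    refine assocSpectrum_le_two hE hL (fun x y z hxy hyy hxz => ?_) (fun x y hxx hxy => ?_) n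
    · by_contra! hcon
      exact hlow fun _ => card_Rset_le_of_fork hxy hyy hxz hcon.1 hcon.2
    · by_contra hyx
      exact hlow fun _ => card_Rset_le_of_loop hxx hxy hyx
  · rintro ⟨h1, h2⟩
    exact absurd ((h2 4 (by omega)).trans (h1 4 (by omega))) (not_le.2 two_lt_card_Rset_three)
end
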